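/- (Euler pairing identities for an exceptional triple.) With e_α, e_γ, e_β the exceptional characters associated to (p−1)/2ⁿ, p/2ⁿ and (p+1)/2ⁿ respectively, the following hold: χ(e_α, e_γ) = 3·ch₀(e_β); χ(e_γ, e_β) = 3·ch₀(e_α); χ(e_α, e_γ)·χ(e_γ, e_β) − χ(e_α, e_β) = 3·ch₀(e_γ); and χ(τ(e_β), e_α)·χ(e_α, e_γ) − χ(τ(e_β), e_γ) = 3·ch₀(e_α). -/

import Mathlib

/-- The Euler pairing (Hirzebruch–Riemann–Roch on P²) on `K(P²)⊗ℝ ≅ ℝ³`,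
identifying `v = (ch₀ v, ch₁ v, ch₂ v)`. -/
noncomputable def chi (v w : ℝ × ℝ × ℝ) : ℝ :=
  v.2.2 * w.1 + w.2.2 * v.1 - v.2.1 * w.2.1 + (3 / 2) * (w.2.1 * v.1 - w.1 * v.2.1) + v.1 * w.1

/-- The Serre twist `τ(v)`, the Chern character of `V ⊗ O(−3)`. -/
noncomputable def tau (v : ℝ × ℝ × ℝ) : ℝ × ℝ × ℝ :=
  (v.1, v.2.1 - 3 * v.1, v.2.2 - 3 * v.2.1 + (9 / 2) * v.1)

/-- `vtil m p` is the exceptional character `ṽ(p / 2^m) ∈ ℝ³`, defined recursively: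
`ṽ(n) = (1, n, n²/2)` for integers `n`; for odd `p` and `m > 0`,
if `p ≡ 3 (mod 4)` then `ṽ(p/2^m) = 3·ch₀(ṽ((p+1)/2^m))·ṽ((p−1)/2^m) − ṽ((p−3)/2^m)`,
and if `p ≡ 1 (mod 4)` then `ṽ(p/2^m) = 3·ch₀(ṽ((p−1)/2^m))·ṽ((p+1)/2^m) − ṽ((p+3)/2^m)`.
For even `p` we reduce the fraction, so `vtil` is well defined on dyadic rationals
(each dyadic rational `q` is represented as `p / 2^m`). -/
noncomputable def vtil : ℕ → ℤ → ℝ × ℝ × ℝ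
  | 0, p => (1, (p : ℝ), (p : ℝ) ^ 2 / 2)
  | m + 1, p =>
    if p % 2 = 0 then vtil m (p / 2)
    else if p % 4 = 3 then
      (3 * (vtil m ((p + 1) / 2)).1) • vtil m ((p - 1) / 2) - vtil m ((p - 3) / 2)
    else
      (3 * (vtil m ((p - 1) / 2)).1) • vtil m ((p + 1) / 2) - vtil m ((p + 3) / 2)

/-- Numerical conditions satisfied by the characters `(a, c, b)` of an exceptional triple on `P²`:
the Gram matrix of `chi` is unipotent upper triangular, with the stated entries in terms of
ranks. -/
structure IsExceptionalTriple (a c b : ℝ × ℝ × ℝ) : Prop where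
  left_self : chi a a = 1
  mid_self : chi c c = 1
  right_self : chi b b = 1
  mid_left : chi c a = 0
  right_mid : chi b c = 0
  right_left : chi b a = 0
  left_mid : chi a c = 3 * b.1
  mid_right : chi c b = 3 * a.1
  left_right : chi a b = 9 * a.1 * b.1 - 3 * c.1

theorem chi_smul_sub_left (t : ℝ) (u v w : ℝ × ℝ × ℝ) :
    chi (t • u - v) w = t * chi u w - chi v w := by
  simp only [chi, Prod.fst_sub, Prod.snd_sub, Prod.smul_fst, Prod.smul_snd, smul_eq_mul]
  ring

theorem chi_smul_sub_right (t : ℝ) (u v w : ℝ × ℝ × ℝ) :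
    chi w (t • u - v) = t * chi w u - chi w v := by
  simp only [chi, Prod.fst_sub, Prod.snd_sub, Prod.smul_fst, Prod.smul_snd, smul_eq_mul]
  ring

theorem chi_tau_left (v w : ℝ × ℝ × ℝ) :
    chi (tau v) w = 2 * chi v w - chi w v + 9 * v.1 * w.1 := by
  simp only [chi, tau]
  ring

namespace IsExceptionalTriple

variable {a c b : ℝ × ℝ × ℝ}

/-- The mutation replacing `(a, c, b)` by a triple starting at `c` and ending at `b`. -/
theorem mutate_left (h : IsExceptionalTriple a c b) :
    IsExceptionalTriple c ((3 * b.1) • c - a) b := by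
  obtain ⟨haa, hcc, hbb, hca, hbc, hba, hac, hcb, hab⟩ := h
  constructor <;>
    simp only [chi_smul_sub_left, chi_smul_sub_right, haa, hcc, hbb, hca, hbc, hba, hac, hcb, hab,
      Prod.fst_sub, Prod.smul_fst, smul_eq_mul] <;>
    ring

/-- The mutation replacing `(a, c, b)` by a triple starting at `a` and ending at `c`. -/
theorem mutate_right (h : IsExceptionalTriple a c b) :
    IsExceptionalTriple a ((3 * a.1) • c - b) c := by
  obtain ⟨haa, hcc, hbb, hca, hbc, hba, hac, hcb, hab⟩ := h
  constructor <;>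
    simp only [chi_smul_sub_left, chi_smul_sub_right, haa, hcc, hbb, hca, hbc, hba, hac, hcb, hab,
      Prod.fst_sub, Prod.smul_fst, smul_eq_mul] <;>
    ring

end IsExceptionalTriple

theorem vtil_succ_two_mul (m : ℕ) (k : ℤ) : vtil (m + 1) (2 * k) = vtil m k := by
  rw [vtil, if_pos (by omega), show 2 * k / 2 = k by omega]

theorem vtil_succ_four_mul_add_three (m : ℕ) (k : ℤ) :
    vtil (m + 1) (4 * k + 3) =
      (3 * (vtil m (2 * k + 1 + 1)).1) • vtil m (2 * k + 1) - vtil m (2 * k + 1 - 1) := by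
  rw [vtil, if_neg (by omega), if_pos (by omega),
    show (4 * k + 3 + 1) / 2 = 2 * k + 1 + 1 by omega,
    show (4 * k + 3 - 1) / 2 = 2 * k + 1 by omega,
    show (4 * k + 3 - 3) / 2 = 2 * k + 1 - 1 by omega]

theorem vtil_succ_four_mul_add_one (m : ℕ) (k : ℤ) :
    vtil (m + 1) (4 * k + 1) =
      (3 * (vtil m (2 * k + 1 - 1)).1) • vtil m (2 * k + 1) - vtil m (2 * k + 1 + 1) := by
  rw [vtil, if_neg (by omega), if_neg (by omega),
    show (4 * k + 1 - 1) / 2 = 2 * k + 1 - 1 by omega,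
    show (4 * k + 1 + 1) / 2 = 2 * k + 1 by omega,
    show (4 * k + 1 + 3) / 2 = 2 * k + 1 + 1 by omega]

theorem isExceptionalTriple_vtil (n : ℕ) (p : ℤ) (hp : 0 < n → Odd p) :
    IsExceptionalTriple (vtil n (p - 1)) (vtil n p) (vtil n (p + 1)) := by
  induction n generalizing p with
  | zero => constructor <;> simp only [vtil, chi] <;> push_cast <;> ring
  | succ m ih =>
    obtain ⟨j, rfl⟩ := hp m.succ_pos
    obtain ⟨k, rfl | rfl⟩ := j.even_or_odd'
    · have h := (ih (2 * k + 1) fun _ => odd_two_mul_add_one k).mutate_right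
      rw [show 2 * (2 * k) + 1 = 4 * k + 1 by ring, vtil_succ_four_mul_add_one,
        show 4 * k + 1 - 1 = 2 * (2 * k + 1 - 1) by ring,
        show 4 * k + 1 + 1 = 2 * (2 * k + 1) by ring, vtil_succ_two_mul, vtil_succ_two_mul]
      exact h
    · have h := (ih (2 * k + 1) fun _ => odd_two_mul_add_one k).mutate_left
      rw [show 2 * (2 * k + 1) + 1 = 4 * k + 3 by ring, vtil_succ_four_mul_add_three,
        show 4 * k + 3 - 1 = 2 * (2 * k + 1) by ring,
        show 4 * k + 3 + 1 = 2 * (2 * k + 1 + 1) by ring, vtil_succ_two_mul, vtil_succ_two_mul]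
      exact h

/-- Euler pairing identities for an exceptional triple: with `e_α = ṽ((p−1)/2ⁿ)`,
`e_γ = ṽ(p/2ⁿ)`, `e_β = ṽ((p+1)/2ⁿ)` (`p` odd when `n > 0`):
`χ(e_α, e_γ) = 3·ch₀(e_β)`; `χ(e_γ, e_β) = 3·ch₀(e_α)`;
`χ(e_α, e_γ)·χ(e_γ, e_β) − χ(e_α, e_β) = 3·ch₀(e_γ)`; and
`χ(τ(e_β), e_α)·χ(e_α, e_γ) − χ(τ(e_β), e_γ) = 3·ch₀(e_α)`. -/
theorem exceptional_triple_pairing_identities (n : ℕ) (p : ℤ) (hp : 0 < n → Odd p) :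
    chi (vtil n (p - 1)) (vtil n p) = 3 * (vtil n (p + 1)).1 ∧
    chi (vtil n p) (vtil n (p + 1)) = 3 * (vtil n (p - 1)).1 ∧
    chi (vtil n (p - 1)) (vtil n p) * chi (vtil n p) (vtil n (p + 1)) -
      chi (vtil n (p - 1)) (vtil n (p + 1)) = 3 * (vtil n p).1 ∧
    chi (tau (vtil n (p + 1))) (vtil n (p - 1)) * chi (vtil n (p - 1)) (vtil n p) -
      chi (tau (vtil n (p + 1))) (vtil n p) = 3 * (vtil n (p - 1)).1 := by
  have h := isExceptionalTriple_vtil n p hp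
  refine ⟨h.left_mid, h.mid_right, ?_, ?_⟩
  · rw [h.left_mid, h.mid_right, h.left_right]
    ring
  · rw [chi_tau_left, chi_tau_left, h.right_left, h.right_mid, h.left_mid, h.mid_right,
      h.left_right]
    ring
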